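/- arXiv:1802.06844 — 3 statements merged into one kernel-verified Lean document; each statement's English description precedes it below -/
import Mathlib

section
/- Let T₁ and T₂ be arbitrary theories. Then T₁ and T₂ are definitionally mergeable if and only if there exist sets Δ₁₂ and Δ₂₁ of explicit definitions — Δ₁₂ defining each relation symbol of Σ₂ \ Σ₁ in terms of L₁, and Δ₂₁ defining each relation symbol of Σ₁ \ Σ₂ in terms of L₂ — such that T₁ ∪ Δ₁₂ is logically equivalent to T₂ ∪ Δ₂₁. -/
/-!
Formalization framework: first-order logic with equality over purely relational
signatures. A signature is a set `S : Set P` of predicate symbols, where each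
symbol `p : P` has arity `ar p`. `Lang ar S` is the corresponding first-order
language, a theory is a set of sentences of that language, and `STheory`
bundles a theory with its signature.
-/

open FirstOrder Language

namespace DefEqPaper

variable {P : Type} {ar : P → ℕ}

/-- The first-order language (purely relational) of the signature `S`. -/
def Lang (ar : P → ℕ) (S : Set P) : FirstOrder.Language where
  Functions _ := Empty
  Relations n := {p : P // p ∈ S ∧ ar p = n}

/-- A theory together with its signature. -/
structure STheory (P : Type) (ar : P → ℕ) where
  sig : Set P
  th : (Lang ar sig).Theory

/-- The inclusion of languages induced by an inclusion of signatures. -/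
def langIncl {S S' : Set P} (h : S ⊆ S') : Lang ar S →ᴸ Lang ar S' where
  onFunction _ f := f.elim
  onRelation _ r := ⟨r.1, h r.2.1, r.2.2⟩

/-- Logical equivalence: two theories of the same language having the same class
of models. -/
def TheoryEquiv {L : FirstOrder.Language} (T T' : L.Theory) : Prop :=
  ∀ (M : Type) [L.Structure M] [Nonempty M], (M ⊨ T ↔ M ⊨ T')

/-- The explicit definition `∀ x₁ … xₙ (p(x₁,…,xₙ) ↔ φ(x₁,…,xₙ))` of a relation
symbol `p ∈ S'` by a formula `φ` of the language of `S`, as a sentence of the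
language of `S'`. -/
def explicitDef {S S' : Set P} (h : S ⊆ S') {p : P} (hp : p ∈ S')
    (φ : (Lang ar S).Formula (Fin (ar p))) : (Lang ar S').Sentence :=
  (BoundedFormula.iff
    (Relations.boundedFormula (⟨p, hp, rfl⟩ : (Lang ar S').Relations (ar p))
      (fun i => Term.var (Sum.inr i)))
    (BoundedFormula.relabel Sum.inr ((langIncl h).onFormula φ))).alls

/-- `Δ` is a set consisting of one explicit definition, in terms of the language
of `S`, for each relation symbol of `S' \ S`. -/
def IsDefinitionSet {S S' : Set P} (h : S ⊆ S') (Δ : Set ((Lang ar S').Sentence)) : Prop :=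
  ∃ d : (p : P) → p ∈ S' → p ∉ S → (Lang ar S).Formula (Fin (ar p)),
    Δ = {σ | ∃ (p : P) (hp : p ∈ S') (hn : p ∉ S), σ = explicitDef h hp (d p hp hn)}

/-- `T'` is a definitional extension of `T`: the signature of `T'` contains that of
`T` and `T'` is logically equivalent to `T ∪ Δ` for a set `Δ` of explicit
definitions, in terms of the language of `T`, of the new relation symbols. -/
def DefExt (T T' : STheory P ar) : Prop :=
  ∃ h : T.sig ⊆ T'.sig, ∃ Δ : Set ((Lang ar T'.sig).Sentence),
    IsDefinitionSet h Δ ∧ TheoryEquiv ((langIncl h).onTheory T.th ∪ Δ) T'.th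

/-- `T₁` and `T₂` are definitionally mergeable (Barrett–Halvorson): they have a
common definitional extension. -/
def Mergeable (T₁ T₂ : STheory P ar) : Prop :=
  ∃ T' : STheory P ar, DefExt T₁ T' ∧ DefExt T₂ T'

/-- Definitional equivalence (Andréka–Németi): there is a finite chain of theories
connecting `T` and `T'` in which each consecutive pair is related by definitional
extension in one direction or the other. -/
def DefEquiv : STheory P ar → STheory P ar → Prop :=
  Relation.ReflTransGen (fun T T' => DefExt T T' ∨ DefExt T' T)

/-- Renaming of signatures along an arity-preserving map, as a map of languages. -/
def renameLHom {S S' : Set P} (ρ : P → P) (hmap : Set.MapsTo ρ S S')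
    (har : ∀ p ∈ S, ar (ρ p) = ar p) : Lang ar S →ᴸ Lang ar S' where
  onFunction _ f := f.elim
  onRelation _ r := ⟨ρ r.1, hmap r.2.1, (har r.1 r.2.1).trans r.2.2⟩

/-- `T'` is a disjoint renaming of `T`: their signatures are disjoint and there is
an arity-preserving bijection between the signatures under which the sentences of
`T'` are exactly the renamings of the sentences of `T`. -/
def IsDisjointRenaming (T T' : STheory P ar) : Prop :=
  Disjoint T.sig T'.sig ∧
    ∃ (ρ : P → P) (hbij : Set.BijOn ρ T.sig T'.sig)
      (har : ∀ p ∈ T.sig, ar (ρ p) = ar p),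
      T'.th = (renameLHom ρ hbij.mapsTo har).onTheory T.th

/-- The variable of a term of a purely relational language. -/
def termVar {S : Set P} {β : Type} : (Lang ar S).Term β → β
  | .var v => v
  | .func f _ => f.elim

/-- The translation of formulas induced by a map `t` sending each `n`-ary relation
symbol of the language of `S₁` to a formula of the language of `S₂` with (at most)
`n` free variables.  It maps `p(x₁,…,xₙ)` to `(t p)(x₁,…,xₙ)` and commutes with
equality and all connectives and quantifiers. -/
def trBF {S₁ S₂ : Set P} (t : ∀ n, (Lang ar S₁).Relations n → (Lang ar S₂).Formula (Fin n)) :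
    ∀ {α : Type} {n : ℕ}, (Lang ar S₁).BoundedFormula α n → (Lang ar S₂).BoundedFormula α n
  | _, _, .falsum => .falsum
  | _, _, .equal t₁ t₂ => .equal (.var (termVar t₁)) (.var (termVar t₂))
  | _, _, .rel R ts => BoundedFormula.relabel (fun i => termVar (ts i)) (t _ R)
  | _, _, .imp f g => (trBF t f).imp (trBF t g)
  | _, _, .all f => (trBF t f).all

/-- `φ` is a semantic consequence of the theory `T`. -/
def Conseq {L : FirstOrder.Language} (T : L.Theory) (φ : L.Sentence) : Prop :=
  ∀ (M : Type) [L.Structure M] [Nonempty M], M ⊨ T → M ⊨ φ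

/-- The map `t` on relation symbols induces a translation of the theory `T₁` to the
theory `T₂`: it maps consequences of `T₁` to consequences of `T₂`. -/
def IsTranslation (T₁ T₂ : STheory P ar)
    (t : ∀ n, (Lang ar T₁.sig).Relations n → (Lang ar T₂.sig).Formula (Fin n)) : Prop :=
  ∀ φ : (Lang ar T₁.sig).Sentence, Conseq T₁.th φ → Conseq T₂.th (trBF t φ)

/-- `T₁` and `T₂` are intertranslatable: there are translations `t₁₂` of `T₁` to `T₂`
and `t₂₁` of `T₂` to `T₁` such that
`T₁ ⊨ ∀ x̄ (φ(x̄) ↔ tr₂₁(tr₁₂(φ(x̄))))` for every formula `φ` of the language of `T₁`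
and `T₂ ⊨ ∀ x̄ (ψ(x̄) ↔ tr₁₂(tr₂₁(ψ(x̄))))` for every formula `ψ` of the language of `T₂`. -/
def Intertranslatable (T₁ T₂ : STheory P ar) : Prop :=
  ∃ (t₁₂ : ∀ n, (Lang ar T₁.sig).Relations n → (Lang ar T₂.sig).Formula (Fin n))
    (t₂₁ : ∀ n, (Lang ar T₂.sig).Relations n → (Lang ar T₁.sig).Formula (Fin n)),
    IsTranslation T₁ T₂ t₁₂ ∧ IsTranslation T₂ T₁ t₂₁ ∧
    (∀ (n : ℕ) (φ : (Lang ar T₁.sig).BoundedFormula Empty n),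
      Conseq T₁.th ((φ.iff (trBF t₂₁ (trBF t₁₂ φ))).alls)) ∧
    (∀ (n : ℕ) (ψ : (Lang ar T₂.sig).BoundedFormula Empty n),
      Conseq T₂.th ((ψ.iff (trBF t₁₂ (trBF t₂₁ ψ))).alls))

/-- The structure `tr*(𝔐)` induced on the underlying set of a structure `𝔐` for the
language of `S₂` by a translation-map `t`: each relation symbol `R` is interpreted by
the relation defined by the formula `t R` in `𝔐`. -/
def trStruc {S₁ S₂ : Set P} (t : ∀ n, (Lang ar S₁).Relations n → (Lang ar S₂).Formula (Fin n))
    (M : Type) (inst : (Lang ar S₂).Structure M) : (Lang ar S₁).Structure M where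
  funMap f _ := f.elim
  RelMap {n} R x := letI := inst; (t n R).Realize x

end DefEqPaper

namespace DefEqPaper

/-- The reduct of a structure along an inclusion of signatures. -/
@[reducible] def sigReduct {S S' : Set P} (h : S ⊆ S') {M : Type}
    (I : (Lang ar S').Structure M) : (Lang ar S).Structure M :=
  letI := I; (langIncl h).reduct M

/-- The set of explicit definitions given by a family of defining formulas. -/
def definitionSet {S S' : Set P} (h : S ⊆ S')
    (d : (p : P) → p ∈ S' → p ∉ S → (Lang ar S).Formula (Fin (ar p))) :
    Set ((Lang ar S').Sentence) :=
  {σ | ∃ (p : P) (hp : p ∈ S') (hn : p ∉ S), σ = explicitDef h hp (d p hp hn)}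

lemma realize_langIncl {S S' : Set P} (h : S ⊆ S') {M : Type} (I : (Lang ar S').Structure M)
    {α : Type} (φ : (Lang ar S).Formula α) (x : α → M) :
    ((langIncl h).onFormula φ).Realize x ↔ @Formula.Realize _ M (sigReduct h I) _ φ x := by
  let _ := sigReduct h I
  have : (langIncl (ar := ar) h).IsExpansionOn M := LHom.isExpansionOn_reduct _ M
  exact LHom.realize_onFormula _ φ

lemma realize_explicitDef {S S' : Set P} (h : S ⊆ S') {p : P} (hp : p ∈ S')
    (φ : (Lang ar S).Formula (Fin (ar p))) {M : Type} (I : (Lang ar S').Structure M) :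
    M ⊨ explicitDef h hp φ ↔ ∀ x : Fin (ar p) → M,
      (I.RelMap (⟨p, hp, rfl⟩ : (Lang ar S').Relations (ar p)) x ↔
        @Formula.Realize _ M (sigReduct h I) _ φ x) := by
  refine BoundedFormula.realize_alls.trans (forall_congr' fun x =>
    BoundedFormula.realize_iff.trans (iff_congr BoundedFormula.realize_rel ?_))
  rw [← realize_langIncl]
  refine BoundedFormula.realize_relabel.trans ?_
  simp [Formula.Realize, Function.comp_def, Subsingleton.elim (_ : Fin 0 → M) default]

lemma model_union_definitionSet {S S' : Set P} (h : S ⊆ S') (T : (Lang ar S).Theory)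
    (d : (p : P) → p ∈ S' → p ∉ S → (Lang ar S).Formula (Fin (ar p)))
    {M : Type} (I : (Lang ar S').Structure M) :
    M ⊨ (langIncl h).onTheory T ∪ definitionSet h d ↔
      @Theory.Model _ M (sigReduct h I) T ∧ ∀ p hp hn (x : Fin (ar p) → M),
        (I.RelMap (⟨p, hp, rfl⟩ : (Lang ar S').Relations (ar p)) x ↔
          @Formula.Realize _ M (sigReduct h I) _ (d p hp hn) x) := by
  rw [Theory.model_union_iff]
  refine and_congr ?_ ?_
  · let _ := sigReduct h I
    have : (langIncl (ar := ar) h).IsExpansionOn M := LHom.isExpansionOn_reduct _ M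
    exact LHom.onTheory_model _ T
  · constructor
    · exact fun H p hp hn => (realize_explicitDef h hp _ I).1
        (H.realize_of_mem _ ⟨p, hp, hn, rfl⟩)
    · rintro H
      refine ⟨?_⟩
      rintro _ ⟨p, hp, hn, rfl⟩
      exact (realize_explicitDef h hp _ I).2 (H p hp hn)

lemma sigReduct_sigReduct {S U S' : Set P} (h : S ⊆ U) (h' : U ⊆ S') {M : Type}
    (J : (Lang ar S').Structure M) :
    sigReduct h (sigReduct h' J) = sigReduct (h.trans h') J := by
  refine Structure.ext ?_ rfl
  funext n f
  exact f.elim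

open Classical in
/-- The expansion of a structure for the signature `U` to the signature `S'`, interpreting the
symbols outside `U` by formulas in the smaller signature `S`. -/
@[reducible] noncomputable def defExpansion {S U S' : Set P} (h : S ⊆ U)
    (d : (p : P) → p ∈ S' → p ∉ S → (Lang ar S).Formula (Fin (ar p)))
    {M : Type} (I : (Lang ar U).Structure M) : (Lang ar S').Structure M where
  funMap f _ := f.elim
  RelMap {n} R x :=
    if hU : R.1 ∈ U then I.RelMap (⟨R.1, hU, R.2.2⟩ : (Lang ar U).Relations n) x
    else @Formula.Realize _ M (sigReduct h I) _ (d R.1 R.2.1 fun hS => hU (h hS))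
      (fun i => x (Fin.cast R.2.2 i))

lemma sigReduct_defExpansion {S U S' : Set P} (h : S ⊆ U) (h' : U ⊆ S')
    (d : (p : P) → p ∈ S' → p ∉ S → (Lang ar S).Formula (Fin (ar p)))
    {M : Type} (I : (Lang ar U).Structure M) :
    sigReduct h' (defExpansion h d I) = I := by
  refine Structure.ext ?_ ?_
  · funext n f
    exact f.elim
  · funext n R x
    exact dif_pos R.2.1

/-- The models of a definitional extension to `U` are the reducts of the models of a
definitional extension to `S' ⊇ U` by more definitions. -/
lemma model_restrict_iff_exists_expansion {S U S' : Set P} (h : S ⊆ U) (h' : U ⊆ S')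
    (T : (Lang ar S).Theory)
    (d : (p : P) → p ∈ S' → p ∉ S → (Lang ar S).Formula (Fin (ar p)))
    {M : Type} (I : (Lang ar U).Structure M) :
    M ⊨ (langIncl h).onTheory T ∪ definitionSet h (fun p hp => d p (h' hp)) ↔
      ∃ J : (Lang ar S').Structure M, sigReduct h' J = I ∧
        M ⊨ (langIncl (h.trans h')).onTheory T ∪ definitionSet (h.trans h') d := by
  simp only [model_union_definitionSet]
  constructor
  · rintro ⟨hT, hd⟩
    have hI := sigReduct_defExpansion h h' d I
    refine ⟨defExpansion h d I, hI, ?_⟩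
    rw [← sigReduct_sigReduct h h', hI]
    refine ⟨hT, fun p hp hn x => ?_⟩
    by_cases hU : p ∈ U
    · rw [← hd p hU hn x]
      exact iff_of_eq (dif_pos hU)
    · exact iff_of_eq (dif_neg hU)
  · rintro ⟨J, rfl, hT, hd⟩
    rw [sigReduct_sigReduct]
    exact ⟨hT, fun p hp hn x => hd p (h' hp) hn x⟩

/-- Lemma 1: `T₁` and `T₂` are definitionally mergeable iff there are sets `Δ₁₂` and
`Δ₂₁` of explicit definitions — `Δ₁₂` defining each relation symbol of `Σ₂ \ Σ₁` in
terms of the language of `T₁`, and `Δ₂₁` defining each relation symbol of `Σ₁ \ Σ₂`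
in terms of the language of `T₂` — such that `T₁ ∪ Δ₁₂` is logically equivalent to
`T₂ ∪ Δ₂₁`. -/
theorem mergeable_iff_explicit_definitions {P : Type} {ar : P → ℕ} (T₁ T₂ : STheory P ar) :
    Mergeable T₁ T₂ ↔
      ∃ (Δ₁₂ : Set ((Lang ar (T₁.sig ∪ T₂.sig)).Sentence))
        (Δ₂₁ : Set ((Lang ar (T₁.sig ∪ T₂.sig)).Sentence)),
        IsDefinitionSet (Set.subset_union_left : T₁.sig ⊆ T₁.sig ∪ T₂.sig) Δ₁₂ ∧
        IsDefinitionSet (Set.subset_union_right : T₂.sig ⊆ T₁.sig ∪ T₂.sig) Δ₂₁ ∧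
        TheoryEquiv
          ((langIncl (Set.subset_union_left : T₁.sig ⊆ T₁.sig ∪ T₂.sig)).onTheory T₁.th ∪ Δ₁₂)
          ((langIncl (Set.subset_union_right : T₂.sig ⊆ T₁.sig ∪ T₂.sig)).onTheory T₂.th ∪ Δ₂₁) := by
  constructor
  · rintro ⟨T', ⟨h₁, _, ⟨d₁, rfl⟩, e₁⟩, ⟨h₂, _, ⟨d₂, rfl⟩, e₂⟩⟩
    have hU : T₁.sig ∪ T₂.sig ⊆ T'.sig := Set.union_subset h₁ h₂
    refine ⟨definitionSet _ fun p hp => d₁ p (hU hp), definitionSet _ fun p hp => d₂ p (hU hp),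
      ⟨_, rfl⟩, ⟨_, rfl⟩, fun M I _ => ?_⟩
    rw [model_restrict_iff_exists_expansion _ hU, model_restrict_iff_exists_expansion _ hU]
    exact exists_congr fun J => and_congr_right fun _ => (e₁ M).trans (e₂ M).symm
  · rintro ⟨Δ₁₂, Δ₂₁, h₁, h₂, e⟩
    exact ⟨⟨T₁.sig ∪ T₂.sig, (langIncl Set.subset_union_left).onTheory T₁.th ∪ Δ₁₂⟩,
      ⟨Set.subset_union_left, Δ₁₂, h₁, fun _ _ _ => Iff.rfl⟩,
      ⟨Set.subset_union_right, Δ₂₁, h₂, fun M _ _ => (e M).symm⟩⟩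

end DefEqPaper
end

section
/- Definitional equivalence is the transitive closure of definitional mergeability: T₁ ≡Δ T₂ holds if and only if there is a finite chain of theories T₁ = S₁, …, Sₖ = T₂ with S_i ⋈ S_{i+1} for all 1 ≤ i < k. Consequently, definitional equivalence is the finest (smallest) equivalence relation containing definitional mergeability. -/
/-!
Formalization framework: first-order logic with equality over purely relational
signatures. A signature is a set `S : Set P` of predicate symbols, where each
symbol `p : P` has arity `ar p`. `Lang ar S` is the corresponding first-order
language, a theory is a set of sentences of that language, and `STheory`
bundles a theory with its signature.
-/

open FirstOrder Language

namespace DefEqPaper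

/-- The inclusion of a signature in itself leaves every structure unchanged. -/
instance langIncl_refl_isExpansionOn {P : Type} {ar : P → ℕ} (S : Set P) (M : Type)
    [(Lang ar S).Structure M] : (langIncl (ar := ar) (Set.Subset.refl S)).IsExpansionOn M where
  map_onFunction f _ := f.elim
  map_onRelation _ _ := rfl

theorem DefExt.refl {P : Type} {ar : P → ℕ} (T : STheory P ar) : DefExt T T := by
  refine ⟨Set.Subset.refl _, ∅, ⟨fun _ hp hn => absurd hp hn, ?_⟩, fun M _ _ => ?_⟩
  · ext σ
    simp only [Set.mem_empty_iff_false, Set.mem_ofPred_eq, false_iff]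
    rintro ⟨_, hp, hn, -⟩
    exact hn hp
  · rw [Set.union_empty]
    exact LHom.onTheory_model _ T.th

theorem DefExt.mergeable {P : Type} {ar : P → ℕ} {T T' : STheory P ar} (h : DefExt T T') :
    Mergeable T T' :=
  ⟨T', h, DefExt.refl T'⟩

theorem Mergeable.symm {P : Type} {ar : P → ℕ} {T T' : STheory P ar} (h : Mergeable T T') :
    Mergeable T' T :=
  let ⟨U, hU, hU'⟩ := h
  ⟨U, hU', hU⟩

theorem Mergeable.defEquiv {P : Type} {ar : P → ℕ} {T T' : STheory P ar} (h : Mergeable T T') :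
    DefEquiv T T' :=
  let ⟨_, hU, hU'⟩ := h
  Relation.ReflTransGen.head (Or.inl hU) (Relation.ReflTransGen.single (Or.inr hU'))

theorem DefEquiv.reflTransGen_mergeable {P : Type} {ar : P → ℕ} {T T' : STheory P ar}
    (h : DefEquiv T T') : Relation.ReflTransGen (fun T T' => Mergeable T T') T T' :=
  Relation.ReflTransGen.mono
    (fun _ _ h => h.elim DefExt.mergeable fun h => h.mergeable.symm) _ _ h

/-- Theorem 5: definitional equivalence is the transitive closure of definitional
mergeability (`T₁ ≡Δ T₂` iff there is a finite chain of theories from `T₁` to `T₂`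
with all consecutive theories definitionally mergeable), and hence it is the finest
equivalence relation containing definitional mergeability. -/
theorem defEquiv_transitive_closure_of_mergeable (P : Type) (ar : P → ℕ) :
    (∀ T₁ T₂ : STheory P ar,
      DefEquiv T₁ T₂ ↔ Relation.ReflTransGen (fun T T' => Mergeable T T') T₁ T₂) ∧
    (∀ r : STheory P ar → STheory P ar → Prop, Equivalence r →
      (∀ A B, Mergeable A B → r A B) → ∀ A B, DefEquiv A B → r A B) := by
  refine ⟨fun T₁ T₂ => ⟨DefEquiv.reflTransGen_mergeable, fun h => ?_⟩, fun r hr hM A B h => ?_⟩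
  · induction h with
    | refl => exact Relation.ReflTransGen.refl
    | tail _ hbc ih => exact Relation.ReflTransGen.trans ih hbc.defEquiv
  · replace h := h.reflTransGen_mergeable
    induction h with
    | refl => exact hr.refl A
    | tail _ hbc ih => exact hr.trans ih (hM _ _ hbc)

end DefEqPaper
end

section
/- Let T₁ and T₂ be arbitrary theories. Then T₁ and T₂ are intertranslatable if and only if they are model intertranslatable, i.e. T₁ ⇄ T₂ ⟺ Mod(T₁) ⇄ Mod(T₂). -/
/-!
Formalization framework: first-order logic with equality over purely relational
signatures. A signature is a set `S : Set P` of predicate symbols, where each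
symbol `p : P` has arity `ar p`. `Lang ar S` is the corresponding first-order
language, a theory is a set of sentences of that language, and `STheory`
bundles a theory with its signature.
-/

open FirstOrder Language

namespace DefEqPaper

variable {P : Type} {ar : P → ℕ}

/-- Model intertranslatability: there are translations `t₁₂` of `T₁` to `T₂` and `t₂₁`
of `T₂` to `T₁` such that the induced maps `tr*₁₂ : Mod(T₂) → Mod(T₁)` and
`tr*₂₁ : Mod(T₁) → Mod(T₂)` (which keep the underlying set and interpret each relation
symbol by the relation defined by its translating formula) are bijections which are
inverses of each other. -/
def ModelIntertranslatable (T₁ T₂ : STheory P ar) : Prop :=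
  ∃ (t₁₂ : ∀ n, (Lang ar T₁.sig).Relations n → (Lang ar T₂.sig).Formula (Fin n))
    (t₂₁ : ∀ n, (Lang ar T₂.sig).Relations n → (Lang ar T₁.sig).Formula (Fin n)),
    IsTranslation T₁ T₂ t₁₂ ∧ IsTranslation T₂ T₁ t₂₁ ∧
    ∃ (F : Theory.ModelType.{0,0,0} T₂.th → Theory.ModelType.{0,0,0} T₁.th)
      (G : Theory.ModelType.{0,0,0} T₁.th → Theory.ModelType.{0,0,0} T₂.th),
      (∀ M, ((F M : Type) = (M : Type)) ∧
        HEq (F M).struc (trStruc t₁₂ (M : Type) M.struc)) ∧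
      (∀ N, ((G N : Type) = (N : Type)) ∧
        HEq (G N).struc (trStruc t₂₁ (N : Type) N.struc)) ∧
      Function.LeftInverse G F ∧ Function.LeftInverse F G

end DefEqPaper

namespace DefEqPaper

section Semantics

variable {P : Type} {ar : P → ℕ} {S₁ S₂ : Set P}

lemma realize_eq_termVar {S : Set P} {M β : Type} [(Lang ar S).Structure M] (v : β → M)
    (u : (Lang ar S).Term β) : u.realize v = v (termVar u) := by
  cases u with
  | var => rfl
  | func f _ => exact f.elim

/-- A formula holds in the structure induced by a translation iff its translation holds
in the original structure. -/
lemma realize_trBF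
    (t : ∀ n, (Lang ar S₁).Relations n → (Lang ar S₂).Formula (Fin n))
    {M : Type} (inst : (Lang ar S₂).Structure M) {α : Type} {n : ℕ}
    (φ : (Lang ar S₁).BoundedFormula α n) (v : α → M) (xs : Fin n → M) :
    (trBF t φ).Realize v xs ↔
      @BoundedFormula.Realize (Lang ar S₁) M (trStruc t M inst) α n φ v xs := by
  let := trStruc t M inst
  induction φ with
  | falsum =>
    rw [trBF]
    rfl
  | equal t₁ t₂ =>
    rw [trBF]
    change Sum.elim v xs _ = Sum.elim v xs _ ↔ t₁.realize _ = t₂.realize _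
    rw [realize_eq_termVar, realize_eq_termVar]
  | rel R ts =>
    rw [trBF]
    refine BoundedFormula.realize_relabel.trans ?_
    change _ ↔ (t _ R).Realize fun i => (ts i).realize _
    simp only [realize_eq_termVar, Formula.Realize]
    exact iff_of_eq (congrArg₂ _ rfl (Subsingleton.elim _ _))
  | imp f g hf hg =>
    rw [trBF]
    exact imp_congr (hf xs) (hg xs)
  | all f hf =>
    rw [trBF]
    exact forall_congr' fun a => hf _

lemma realize_trBF_trBF
    (t₁₂ : ∀ n, (Lang ar S₁).Relations n → (Lang ar S₂).Formula (Fin n))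
    (t₂₁ : ∀ n, (Lang ar S₂).Relations n → (Lang ar S₁).Formula (Fin n))
    {M : Type} (inst : (Lang ar S₁).Structure M) {α : Type} {n : ℕ}
    (φ : (Lang ar S₁).BoundedFormula α n) (v : α → M) (xs : Fin n → M) :
    (trBF t₂₁ (trBF t₁₂ φ)).Realize v xs ↔
      @BoundedFormula.Realize (Lang ar S₁) M (trStruc t₁₂ M (trStruc t₂₁ M inst)) α n φ v xs :=
  (realize_trBF t₂₁ inst _ v xs).trans (realize_trBF t₁₂ (trStruc t₂₁ M inst) φ v xs)

/-- Translating back and forth preserves all formulas up to equivalence in a structure iff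
the induced maps on structures return that structure. -/
lemma forall_realize_iff_trBF_trBF_iff
    (t₁₂ : ∀ n, (Lang ar S₁).Relations n → (Lang ar S₂).Formula (Fin n))
    (t₂₁ : ∀ n, (Lang ar S₂).Relations n → (Lang ar S₁).Formula (Fin n))
    {M : Type} (inst : (Lang ar S₁).Structure M) :
    (∀ (n : ℕ) (φ : (Lang ar S₁).BoundedFormula Empty n),
      M ⊨ (φ.iff (trBF t₂₁ (trBF t₁₂ φ))).alls) ↔
      trStruc t₁₂ M (trStruc t₂₁ M inst) = inst := by
  simp only [Sentence.Realize, BoundedFormula.realize_alls,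
    BoundedFormula.realize_iff, realize_trBF_trBF]
  constructor
  · intro h
    refine Structure.ext ?_ ?_
    · funext n f
      exact f.elim
    · funext n R x
      exact propext
        (h n (Relations.boundedFormula R fun i => Term.var (Sum.inr i)) x).symm
  · intro h n φ xs
    rw [h]

end Semantics

variable {P : Type} {ar : P → ℕ} {T₁ T₂ : STheory P ar}

lemma IsTranslation.model_trStruc
    {t : ∀ n, (Lang ar T₁.sig).Relations n → (Lang ar T₂.sig).Formula (Fin n)}
    (ht : IsTranslation T₁ T₂ t) {M : Type} [Nonempty M] (inst : (Lang ar T₂.sig).Structure M)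
    (hM : M ⊨ T₂.th) : @Theory.Model (Lang ar T₁.sig) M (trStruc t M inst) T₁.th :=
  letI := trStruc t M inst
  ⟨fun φ hφ => (realize_trBF t inst φ _ _).1
    (ht φ (fun _ _ _ h => h.realize_of_mem φ hφ) M hM)⟩

/-- The map on models induced by a translation. -/
def IsTranslation.mapModel
    {t : ∀ n, (Lang ar T₁.sig).Relations n → (Lang ar T₂.sig).Formula (Fin n)}
    (ht : IsTranslation T₁ T₂ t) (M : Theory.ModelType.{0, 0, 0} T₂.th) :
    Theory.ModelType.{0, 0, 0} T₁.th :=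
  letI := trStruc t M M.struc
  haveI := ht.model_trStruc M.struc M.is_model
  ⟨M⟩

lemma IsTranslation.leftInverse_mapModel
    {t₁₂ : ∀ n, (Lang ar T₁.sig).Relations n → (Lang ar T₂.sig).Formula (Fin n)}
    {t₂₁ : ∀ n, (Lang ar T₂.sig).Relations n → (Lang ar T₁.sig).Formula (Fin n)}
    (h₁₂ : IsTranslation T₁ T₂ t₁₂) (h₂₁ : IsTranslation T₂ T₁ t₂₁)
    (h : ∀ (n : ℕ) (φ : (Lang ar T₁.sig).BoundedFormula Empty n),
      Conseq T₁.th ((φ.iff (trBF t₂₁ (trBF t₁₂ φ))).alls)) :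
    Function.LeftInverse h₁₂.mapModel h₂₁.mapModel := by
  rintro @⟨M, inst, hM, hne⟩
  have key := (forall_realize_iff_trBF_trBF_iff t₁₂ t₂₁ inst).1 fun n φ => h n φ M hM
  simp only [mapModel]
  congr
  exact proof_irrel_heq _ _

lemma heq_trStruc {S₁ S₂ : Set P}
    (t : ∀ n, (Lang ar S₁).Relations n → (Lang ar S₂).Formula (Fin n)) {M N : Type}
    (h : M = N) {s : (Lang ar S₂).Structure M} {s' : (Lang ar S₂).Structure N} (hs : s ≍ s') :
    trStruc t M s ≍ trStruc t N s' := by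
  subst h
  obtain rfl := eq_of_heq hs
  rfl

lemma conseq_iff_trBF_trBF_of_leftInverse
    {t₁₂ : ∀ n, (Lang ar T₁.sig).Relations n → (Lang ar T₂.sig).Formula (Fin n)}
    {t₂₁ : ∀ n, (Lang ar T₂.sig).Relations n → (Lang ar T₁.sig).Formula (Fin n)}
    {F : Theory.ModelType.{0, 0, 0} T₂.th → Theory.ModelType.{0, 0, 0} T₁.th}
    {G : Theory.ModelType.{0, 0, 0} T₁.th → Theory.ModelType.{0, 0, 0} T₂.th}
    (hF : ∀ M, ((F M : Type) = (M : Type)) ∧ HEq (F M).struc (trStruc t₁₂ (M : Type) M.struc))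
    (hG : ∀ N, ((G N : Type) = (N : Type)) ∧ HEq (G N).struc (trStruc t₂₁ (N : Type) N.struc))
    (h : Function.LeftInverse F G) (n : ℕ) (φ : (Lang ar T₁.sig).BoundedFormula Empty n) :
    Conseq T₁.th ((φ.iff (trBF t₂₁ (trBF t₁₂ φ))).alls) := by
  intro M inst _ hM
  refine (forall_realize_iff_trBF_trBF_iff t₁₂ t₂₁ inst).2 ?_ n φ
  let N : Theory.ModelType.{0, 0, 0} T₁.th := ⟨M⟩
  have hFG : (F (G N)).struc ≍ inst := by rw [h N]
  exact eq_of_heq ((heq_trStruc t₁₂ (hG N).1 (hG N).2).symm.trans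
    ((hF (G N)).2.symm.trans hFG))

/-- Theorem 9: two arbitrary theories are intertranslatable iff they are model
intertranslatable. -/
theorem intertranslatable_iff_modelIntertranslatable {P : Type} {ar : P → ℕ}
    (T₁ T₂ : STheory P ar) :
    Intertranslatable T₁ T₂ ↔ ModelIntertranslatable T₁ T₂ := by
  constructor
  · rintro ⟨t₁₂, t₂₁, h₁₂, h₂₁, h₁, h₂⟩
    exact ⟨t₁₂, t₂₁, h₁₂, h₂₁, h₁₂.mapModel, h₂₁.mapModel,
      fun _ => ⟨rfl, HEq.rfl⟩, fun _ => ⟨rfl, HEq.rfl⟩,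
      h₂₁.leftInverse_mapModel h₁₂ h₂, h₁₂.leftInverse_mapModel h₂₁ h₁⟩
  · rintro ⟨t₁₂, t₂₁, h₁₂, h₂₁, F, G, hF, hG, hGF, hFG⟩
    exact ⟨t₁₂, t₂₁, h₁₂, h₂₁, conseq_iff_trBF_trBF_of_leftInverse hF hG hFG,
      conseq_iff_trBF_trBF_of_leftInverse hG hF hGF⟩

end DefEqPaper
end
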